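/- If B = A* D A where D is a diagonal matrix and the regular-rigidity of A satisfies r_A(r) ≤ s (i.e., one can change at most s entries in each row and column of A to obtain a matrix of rank at most r), then r_B(2r) ≤ s². The same conclusion holds for B = A D A. -/

import Mathlib

open Matrix

open scoped Classical in
noncomputable def regRigidity {ι F : Type*} [Fintype ι] [Field F]
    (M : Matrix ι ι F) (r : ℕ) : ℕ :=
  sInf {s : ℕ | ∃ E : Matrix ι ι F,
    (∀ i, (Finset.univ.filter fun j => E i j ≠ 0).card ≤ s) ∧
    (∀ j, (Finset.univ.filter fun i => E i j ≠ 0).card ≤ s) ∧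
    (M - E).rank ≤ r}

open scoped Classical in
/-- Every row and every column of `E` has at most `s` nonzero entries. -/
def Matrix.RegularSparse {ι F : Type*} [Fintype ι] [Field F] (E : Matrix ι ι F) (s : ℕ) : Prop :=
  (∀ i, (Finset.univ.filter fun j => E i j ≠ 0).card ≤ s) ∧
    ∀ j, (Finset.univ.filter fun i => E i j ≠ 0).card ≤ s

section

variable {ι F : Type*} [Fintype ι] [Field F]

theorem Matrix.RegularSparse.of_ne_zero {E E' : Matrix ι ι F} {s : ℕ} (hE : E.RegularSparse s)
    (h : ∀ i j, E' i j ≠ 0 → E i j ≠ 0) : E'.RegularSparse s := by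
  classical
  refine ⟨fun i => le_trans ?_ (hE.1 i), fun j => le_trans ?_ (hE.2 j)⟩
  · exact Finset.card_le_card (Finset.monotone_filter_right _ fun j _ => h i j)
  · exact Finset.card_le_card (Finset.monotone_filter_right _ fun i _ => h i j)

theorem Matrix.RegularSparse.conjTranspose [StarRing F] {E : Matrix ι ι F} {s : ℕ}
    (hE : E.RegularSparse s) : Eᴴ.RegularSparse s := by
  have hT : Eᵀ.RegularSparse s := ⟨hE.2, hE.1⟩
  exact hT.of_ne_zero fun i j h => star_ne_zero.1 h

theorem Matrix.RegularSparse.mul_isDiag {E D : Matrix ι ι F} {s : ℕ}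
    (hE : E.RegularSparse s) (hD : D.IsDiag) : (E * D).RegularSparse s := by
  classical
  refine hE.of_ne_zero fun i j h h0 => h ?_
  rw [← hD.diagonal_diag, mul_diagonal, h0, zero_mul]

open scoped Classical in
theorem Matrix.card_filter_mul_ne_zero_le {X Y : Matrix ι ι F} {a b : ℕ}
    (hX : ∀ i, (Finset.univ.filter fun j => X i j ≠ 0).card ≤ a)
    (hY : ∀ i, (Finset.univ.filter fun j => Y i j ≠ 0).card ≤ b) (i : ι) :
    (Finset.univ.filter fun j => (X * Y) i j ≠ 0).card ≤ a * b := by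
  have hsub : (Finset.univ.filter fun j => (X * Y) i j ≠ 0) ⊆
      (Finset.univ.filter fun k => X i k ≠ 0).biUnion
        fun k => Finset.univ.filter fun j => Y k j ≠ 0 := by
    intro j hj
    obtain ⟨k, -, hk⟩ := Finset.exists_ne_zero_of_sum_ne_zero (Finset.mem_filter.1 hj).2
    simpa using ⟨k, left_ne_zero_of_mul hk, right_ne_zero_of_mul hk⟩
  exact (Finset.card_le_card hsub).trans <|
    (Finset.card_biUnion_le_card_mul _ _ b fun k _ => hY k).trans <|
      Nat.mul_le_mul_right b (hX i)

theorem Matrix.RegularSparse.mul {X Y : Matrix ι ι F} {a b : ℕ}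
    (hX : X.RegularSparse a) (hY : Y.RegularSparse b) : (X * Y).RegularSparse (a * b) := by
  classical
  refine ⟨card_filter_mul_ne_zero_le hX.1 hY.1, fun j => ?_⟩
  have h := card_filter_mul_ne_zero_le (X := Yᵀ) (Y := Xᵀ) hY.2 hX.2 j
  rw [← transpose_mul, mul_comm b a] at h
  exact h

open scoped Classical in
theorem exists_regularSparse_rank_sub_le (M : Matrix ι ι F) (r : ℕ) :
    ∃ E : Matrix ι ι F, E.RegularSparse (regRigidity M r) ∧ (M - E).rank ≤ r := by
  have hne : {s : ℕ | ∃ E : Matrix ι ι F,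
      (∀ i, (Finset.univ.filter fun j => E i j ≠ 0).card ≤ s) ∧
      (∀ j, (Finset.univ.filter fun i => E i j ≠ 0).card ≤ s) ∧
      (M - E).rank ≤ r}.Nonempty :=
    ⟨Fintype.card ι, M, fun _ => Finset.card_le_univ _, fun _ => Finset.card_le_univ _, by simp⟩
  obtain ⟨E, h₁, h₂, h₃⟩ := Nat.sInf_mem hne
  exact ⟨E, ⟨h₁, h₂⟩, h₃⟩

theorem regRigidity_le {M E : Matrix ι ι F} {r s : ℕ} (hE : E.RegularSparse s)
    (h : (M - E).rank ≤ r) : regRigidity M r ≤ s :=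
  Nat.sInf_le ⟨E, hE.1, hE.2, h⟩

theorem Matrix.rank_add_le_rank_add_rank {m n : Type*} [Fintype n] [Finite m]
    (A B : Matrix m n F) : (A + B).rank ≤ A.rank + B.rank := by
  rw [rank, rank, rank, mulVecLin_add]
  exact (Submodule.finrank_mono (LinearMap.range_add_le _ _)).trans
    (Submodule.finrank_add_le_finrank_add_finrank _ _)

theorem regRigidity_mul_isDiag_mul_le {P Q X Y D : Matrix ι ι F} {r r' a b : ℕ} (hD : D.IsDiag)
    (hX : X.RegularSparse a) (hY : Y.RegularSparse b)
    (hP : (P - X).rank ≤ r) (hQ : (Q - Y).rank ≤ r') :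
    regRigidity (P * D * Q) (r + r') ≤ a * b := by
  classical
  refine regRigidity_le ((hX.mul_isDiag hD).mul hY) ?_
  have key : P * D * Q - X * D * Y = (P - X) * (D * Q) + X * D * (Q - Y) := by
    noncomm_ring
  rw [key]
  exact (rank_add_le_rank_add_rank _ _).trans <|
    add_le_add ((rank_mul_le_left _ _).trans hP) ((rank_mul_le_right _ _).trans hQ)

end

/-- If `B = Aᴴ D A` with `D` diagonal and `r_A(r) ≤ s`, then `r_B(2r) ≤ s²`;
the same holds for `B' = A D A`. -/
theorem diagonalization_rigidity {n : ℕ} (A D : Matrix (Fin n) (Fin n) ℂ)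
    (hD : D.IsDiag) (r s : ℕ) (h : regRigidity A r ≤ s) :
    regRigidity (Aᴴ * D * A) (2 * r) ≤ s ^ 2 ∧
    regRigidity (A * D * A) (2 * r) ≤ s ^ 2 := by
  obtain ⟨E, hE, hr⟩ := exists_regularSparse_rank_sub_le A r
  have hs : regRigidity A r * regRigidity A r ≤ s ^ 2 := by
    rw [sq]
    exact Nat.mul_le_mul h h
  have hr' : (Aᴴ - Eᴴ).rank ≤ r := by
    open scoped ComplexOrder in
    rwa [← conjTranspose_sub, rank_conjTranspose]
  rw [two_mul]
  exact ⟨(regRigidity_mul_isDiag_mul_le hD hE.conjTranspose hE hr' hr).trans hs,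
    (regRigidity_mul_isDiag_mul_le hD hE hE hr hr).trans hs⟩
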